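/- Let η : ℝ×ℝ³ → ℝ³, v : ℝ×ℝ³ → ℝ³ and q : ℝ×ℝ³ → ℝ be C^∞ and satisfy the Lagrangian Euler system: ∂_tη = v, ∂_tv_α + a^{μα}∂_μq = 0, and a^{αβ}∂_αv_β = 0 at every point, where a is the cofactor matrix of ∇η and additionally a^{μα}∂_μη^β = δ^{αβ} (i.e. a = (∇η)^{-1}, equivalently det ∇η = 1). Then the time derivative of the Lagrangian pressure satisfies, at every point, ∂_λ( a^{λα} a^{μα} ∂_μ∂_t q ) = ∂_λ 𝑓̃^λ, where 𝑓̃^λ = ∂_t²a^{λα} v_α + ∂_ta^{λα} ∂_t v_α − ∂_ta^{λα} ∂_α q + ∂_ta^{λα}(δ^{μα} − a^{μα})∂_μ q − a^{λα} ∂_t a^{μα} ∂_μ q, with all indices summed over {1,2,3}. -/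

import Mathlib

open MeasureTheory

noncomputable section

/-- The Levi-Civita symbol `ε` on three indices (indices `0,1,2` stand for `1,2,3`). -/
def eps (i j k : Fin 3) : ℝ :=
  if (i, j, k) = ((0 : Fin 3), (1 : Fin 3), (2 : Fin 3)) ∨ (i, j, k) = (1, 2, 0) ∨
      (i, j, k) = (2, 0, 1) then 1
  else if (i, j, k) = ((0 : Fin 3), (2 : Fin 3), (1 : Fin 3)) ∨ (i, j, k) = (2, 1, 0) ∨
      (i, j, k) = (1, 0, 2) then -1
  else 0

/-- Time derivative `∂_t` of a scalar field on `ℝ × ℝ³`. -/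
def Dt (f : ℝ × (Fin 3 → ℝ) → ℝ) : ℝ × (Fin 3 → ℝ) → ℝ :=
  fun p => deriv (fun s => f (s, p.2)) p.1

/-- Spatial partial derivative `∂_μ` of a scalar field on `ℝ × ℝ³`
(`μ = 0,1,2` standing for `1,2,3`). -/
def Dx (μ : Fin 3) (f : ℝ × (Fin 3 → ℝ) → ℝ) : ℝ × (Fin 3 → ℝ) → ℝ :=
  fun p => fderiv ℝ (fun y => f (p.1, y)) p.2 (Pi.single μ 1)

/-- The cofactor matrix `a` of `∇η`: `a^{1α} = ε^{αλτ}∂₂η_λ∂₃η_τ`,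
`a^{2α} = −ε^{αλτ}∂₁η_λ∂₃η_τ`, `a^{3α} = ε^{αλτ}∂₁η_λ∂₂η_τ`. -/
def cof (η : ℝ × (Fin 3 → ℝ) → Fin 3 → ℝ) (μ α : Fin 3) : ℝ × (Fin 3 → ℝ) → ℝ :=
  fun p =>
    if μ = 0 then
      ∑ lam : Fin 3, ∑ τ : Fin 3,
        eps α lam τ * Dx 1 (fun r => η r lam) p * Dx 2 (fun r => η r τ) p
    else if μ = 1 then
      - ∑ lam : Fin 3, ∑ τ : Fin 3,
        eps α lam τ * Dx 0 (fun r => η r lam) p * Dx 2 (fun r => η r τ) p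
    else
      ∑ lam : Fin 3, ∑ τ : Fin 3,
        eps α lam τ * Dx 0 (fun r => η r lam) p * Dx 1 (fun r => η r τ) p

lemma Dt_eq_fderiv {f : ℝ × (Fin 3 → ℝ) → ℝ} (hf : Differentiable ℝ f)
    (p : ℝ × (Fin 3 → ℝ)) : Dt f p = fderiv ℝ f p (1, 0) := by
  have h : HasDerivAt (fun s : ℝ => (s, p.2)) ((1 : ℝ), (0 : Fin 3 → ℝ)) p.1 :=
    (hasDerivAt_id p.1).prodMk (hasDerivAt_const p.1 p.2)
  exact ((hf p).hasFDerivAt.comp_hasDerivAt (x := p.1) (f := fun s : ℝ => (s, p.2)) h).deriv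

lemma Dx_eq_fderiv (μ : Fin 3) {f : ℝ × (Fin 3 → ℝ) → ℝ} (hf : Differentiable ℝ f)
    (p : ℝ × (Fin 3 → ℝ)) : Dx μ f p = fderiv ℝ f p (0, Pi.single μ 1) := by
  have h : HasFDerivAt (fun y : Fin 3 → ℝ => (p.1, y))
      ((0 : (Fin 3 → ℝ) →L[ℝ] ℝ).prod (.id ℝ _)) p.2 :=
    (hasFDerivAt_const p.1 p.2).prodMk (hasFDerivAt_id p.2)
  have h' := ((hf p).hasFDerivAt.comp (x := p.2) (f := fun y : Fin 3 → ℝ => (p.1, y)) h).fderiv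
  have h'' := congrArg (fun L : (Fin 3 → ℝ) →L[ℝ] ℝ => L (Pi.single μ 1)) h'
  simpa [Dx, Function.comp_def] using h''

lemma differentiable_of_smooth {f : ℝ × (Fin 3 → ℝ) → ℝ} (hf : ContDiff ℝ (⊤ : ℕ∞) f) :
    Differentiable ℝ f :=
  hf.differentiable (by simp)

lemma contDiff_fderiv_apply_const {f : ℝ × (Fin 3 → ℝ) → ℝ} (hf : ContDiff ℝ (⊤ : ℕ∞) f)
    (w : ℝ × (Fin 3 → ℝ)) : ContDiff ℝ (⊤ : ℕ∞) (fun p => fderiv ℝ f p w) :=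
  (hf.fderiv_right (m := (⊤ : ℕ∞)) (by simp)).clm_apply contDiff_const

lemma fderiv_apply_comm {f : ℝ × (Fin 3 → ℝ) → ℝ} (hf : ContDiff ℝ (⊤ : ℕ∞) f)
    (u w p : ℝ × (Fin 3 → ℝ)) :
    fderiv ℝ (fun r => fderiv ℝ f r u) p w = fderiv ℝ (fun r => fderiv ℝ f r w) p u := by
  have hd : DifferentiableAt ℝ (fderiv ℝ f) p :=
    (hf.fderiv_right (m := (⊤ : ℕ∞)) (by simp)).differentiable (by simp) p
  have key (x y : ℝ × (Fin 3 → ℝ)) :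
      fderiv ℝ (fun r => fderiv ℝ f r x) p y = fderiv ℝ (fderiv ℝ f) p y x := by
    rw [fderiv_clm_apply hd (differentiableAt_const x)]
    simp
  rw [key, key]
  have h2 : (2 : WithTop ℕ∞) ≤ (⊤ : ℕ∞) := WithTop.coe_le_coe.2 (le_top (a := (2 : ℕ∞)))
  exact (hf.contDiffAt.isSymmSndFDerivAt (by simpa using h2)) w u

lemma Dt_eq {f : ℝ × (Fin 3 → ℝ) → ℝ} (hf : ContDiff ℝ (⊤ : ℕ∞) f) :
    Dt f = fun p => fderiv ℝ f p (1, 0) :=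
  funext (Dt_eq_fderiv (differentiable_of_smooth hf))

lemma Dx_eq (μ : Fin 3) {f : ℝ × (Fin 3 → ℝ) → ℝ} (hf : ContDiff ℝ (⊤ : ℕ∞) f) :
    Dx μ f = fun p => fderiv ℝ f p (0, Pi.single μ 1) :=
  funext (Dx_eq_fderiv μ (differentiable_of_smooth hf))

lemma ContDiff.Dt {f : ℝ × (Fin 3 → ℝ) → ℝ} (hf : ContDiff ℝ (⊤ : ℕ∞) f) :
    ContDiff ℝ (⊤ : ℕ∞) (Dt f) :=
  Dt_eq hf ▸ contDiff_fderiv_apply_const hf _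

lemma ContDiff.Dx (μ : Fin 3) {f : ℝ × (Fin 3 → ℝ) → ℝ} (hf : ContDiff ℝ (⊤ : ℕ∞) f) :
    ContDiff ℝ (⊤ : ℕ∞) (Dx μ f) :=
  Dx_eq μ hf ▸ contDiff_fderiv_apply_const hf _

lemma Dx_Dt_comm (μ : Fin 3) {f : ℝ × (Fin 3 → ℝ) → ℝ} (hf : ContDiff ℝ (⊤ : ℕ∞) f) :
    Dx μ (Dt f) = Dt (Dx μ f) := by
  rw [Dx_eq μ hf.Dt, Dt_eq (hf.Dx μ), Dt_eq hf, Dx_eq μ hf]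
  exact funext (fderiv_apply_comm hf _ _)

lemma Dx_Dx_comm (μ ν : Fin 3) {f : ℝ × (Fin 3 → ℝ) → ℝ} (hf : ContDiff ℝ (⊤ : ℕ∞) f) :
    Dx μ (Dx ν f) = Dx ν (Dx μ f) := by
  rw [Dx_eq μ (hf.Dx ν), Dx_eq ν (hf.Dx μ), Dx_eq μ hf, Dx_eq ν hf]
  exact funext (fderiv_apply_comm hf _ _)

section Calculus

variable {f g : ℝ × (Fin 3 → ℝ) → ℝ}

lemma Dt_mul (hf : ContDiff ℝ (⊤ : ℕ∞) f) (hg : ContDiff ℝ (⊤ : ℕ∞) g) (p : ℝ × (Fin 3 → ℝ)) :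
    Dt (fun r => f r * g r) p = Dt f p * g p + f p * Dt g p := by
  rw [Dt_eq (hf.mul hg), Dt_eq hf, Dt_eq hg]
  simp only [fderiv_fun_mul (differentiable_of_smooth hf p) (differentiable_of_smooth hg p),
    add_apply, smul_apply, smul_eq_mul]
  ring

lemma Dx_mul (μ : Fin 3) (hf : ContDiff ℝ (⊤ : ℕ∞) f) (hg : ContDiff ℝ (⊤ : ℕ∞) g)
    (p : ℝ × (Fin 3 → ℝ)) :
    Dx μ (fun r => f r * g r) p = Dx μ f p * g p + f p * Dx μ g p := by
  rw [Dx_eq μ (hf.mul hg), Dx_eq μ hf, Dx_eq μ hg]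
  simp only [fderiv_fun_mul (differentiable_of_smooth hf p) (differentiable_of_smooth hg p),
    add_apply, smul_apply, smul_eq_mul]
  ring

lemma Dt_add (hf : ContDiff ℝ (⊤ : ℕ∞) f) (hg : ContDiff ℝ (⊤ : ℕ∞) g) (p : ℝ × (Fin 3 → ℝ)) :
    Dt (fun r => f r + g r) p = Dt f p + Dt g p := by
  rw [Dt_eq (hf.add hg), Dt_eq hf, Dt_eq hg]
  simp only [fderiv_fun_add (differentiable_of_smooth hf p) (differentiable_of_smooth hg p),
    add_apply]

lemma Dx_add (μ : Fin 3) (hf : ContDiff ℝ (⊤ : ℕ∞) f) (hg : ContDiff ℝ (⊤ : ℕ∞) g)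
    (p : ℝ × (Fin 3 → ℝ)) :
    Dx μ (fun r => f r + g r) p = Dx μ f p + Dx μ g p := by
  rw [Dx_eq μ (hf.add hg), Dx_eq μ hf, Dx_eq μ hg]
  simp only [fderiv_fun_add (differentiable_of_smooth hf p) (differentiable_of_smooth hg p),
    add_apply]

lemma Dx_sub (μ : Fin 3) (hf : ContDiff ℝ (⊤ : ℕ∞) f) (hg : ContDiff ℝ (⊤ : ℕ∞) g)
    (p : ℝ × (Fin 3 → ℝ)) :
    Dx μ (fun r => f r - g r) p = Dx μ f p - Dx μ g p := by
  rw [Dx_eq μ (hf.sub hg), Dx_eq μ hf, Dx_eq μ hg]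
  simp only [fderiv_fun_sub (differentiable_of_smooth hf p) (differentiable_of_smooth hg p),
    sub_apply]

lemma Dt_neg (f : ℝ × (Fin 3 → ℝ) → ℝ) (p : ℝ × (Fin 3 → ℝ)) :
    Dt (fun r => -f r) p = -Dt f p :=
  deriv.fun_neg

variable {F : Fin 3 → ℝ × (Fin 3 → ℝ) → ℝ}

lemma Dt_sum (hF : ∀ i, ContDiff ℝ (⊤ : ℕ∞) (F i)) (p : ℝ × (Fin 3 → ℝ)) :
    Dt (fun r => ∑ i, F i r) p = ∑ i, Dt (F i) p := by
  rw [Dt_eq (ContDiff.sum fun i _ => hF i)]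
  simp only [fun i => Dt_eq (hF i)]
  rw [fderiv_fun_sum fun i _ => differentiable_of_smooth (hF i) p]
  simp

lemma Dx_sum (μ : Fin 3) (hF : ∀ i, ContDiff ℝ (⊤ : ℕ∞) (F i)) (p : ℝ × (Fin 3 → ℝ)) :
    Dx μ (fun r => ∑ i, F i r) p = ∑ i, Dx μ (F i) p := by
  rw [Dx_eq μ (ContDiff.sum fun i _ => hF i)]
  simp only [fun i => Dx_eq μ (hF i)]
  rw [fderiv_fun_sum fun i _ => differentiable_of_smooth (hF i) p]
  simp

end Calculus

/-- The cofactors written with cyclic indices. -/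
lemma cof_eq_cyclic (η : ℝ × (Fin 3 → ℝ) → Fin 3 → ℝ) (μ α : Fin 3) :
    cof η μ α = fun r =>
      Dx (μ + 1) (fun r => η r (α + 1)) r * Dx (μ + 2) (fun r => η r (α + 2)) r
        - Dx (μ + 2) (fun r => η r (α + 1)) r * Dx (μ + 1) (fun r => η r (α + 2)) r := by
  funext r
  fin_cases μ <;> fin_cases α <;> simp [cof, eps, Fin.sum_univ_three] <;> ring

section Cofactor

variable {η : ℝ × (Fin 3 → ℝ) → Fin 3 → ℝ}

lemma contDiff_cof (hη : ContDiff ℝ (⊤ : ℕ∞) η) (μ α : Fin 3) :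
    ContDiff ℝ (⊤ : ℕ∞) (cof η μ α) := by
  have h := contDiff_pi.1 hη
  rw [cof_eq_cyclic]
  exact (((h _).Dx _).mul ((h _).Dx _)).sub (((h _).Dx _).mul ((h _).Dx _))

/-- The Piola identity `∂_μ a^{μα} = 0`. -/
lemma sum_Dx_cof_eq_zero (hη : ContDiff ℝ (⊤ : ℕ∞) η) (α : Fin 3) (p : ℝ × (Fin 3 → ℝ)) :
    ∑ μ : Fin 3, Dx μ (cof η μ α) p = 0 := by
  have h := contDiff_pi.1 hη
  have hmul (μ ν β γ) : ContDiff ℝ (⊤ : ℕ∞)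
      (fun r => Dx μ (fun r => η r β) r * Dx ν (fun r => η r γ) r) :=
    ((h β).Dx μ).mul ((h γ).Dx ν)
  simp only [cof_eq_cyclic, Dx_sub _ (hmul _ _ _ _) (hmul _ _ _ _),
    Dx_mul _ ((h _).Dx _) ((h _).Dx _)]
  simp only [Fin.sum_univ_three, Fin.isValue, Fin.reduceAdd, zero_add]
  simp only [Dx_Dx_comm 1 0 (h _), Dx_Dx_comm 2 0 (h _), Dx_Dx_comm 2 1 (h _)]
  ring

end Cofactor

/-- The time derivative of the Lagrangian pressure satisfies
`∂_λ(a^{λα} a^{μα} ∂_μ∂_tq) = ∂_λ 𝑓̃^λ` with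
`𝑓̃^λ = ∂_t²a^{λα}v_α + ∂_ta^{λα}∂_tv_α − ∂_ta^{λα}∂_αq + ∂_ta^{λα}(δ^{μα} − a^{μα})∂_μq
  − a^{λα}∂_ta^{μα}∂_μq`. -/
theorem pressure_time_derivative_equation
    (η v : ℝ × (Fin 3 → ℝ) → Fin 3 → ℝ) (q : ℝ × (Fin 3 → ℝ) → ℝ)
    (hη : ContDiff ℝ (⊤ : ℕ∞) η) (hv : ContDiff ℝ (⊤ : ℕ∞) v) (hq : ContDiff ℝ (⊤ : ℕ∞) q)
    (a : Fin 3 → Fin 3 → ℝ × (Fin 3 → ℝ) → ℝ) (ha : ∀ μ α, a μ α = cof η μ α)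
    (hflow : ∀ (p : ℝ × (Fin 3 → ℝ)) (α : Fin 3), Dt (fun r => η r α) p = v p α)
    (heuler : ∀ (p : ℝ × (Fin 3 → ℝ)) (α : Fin 3),
      Dt (fun r => v r α) p + ∑ μ : Fin 3, a μ α p * Dx μ q p = 0)
    (hdiv : ∀ p : ℝ × (Fin 3 → ℝ),
      ∑ α : Fin 3, ∑ β : Fin 3, a α β p * Dx α (fun r => v r β) p = 0)
    (hinv : ∀ (p : ℝ × (Fin 3 → ℝ)) (α β : Fin 3),
      ∑ μ : Fin 3, a μ α p * Dx μ (fun r => η r β) p = if α = β then 1 else 0) :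
    ∀ p : ℝ × (Fin 3 → ℝ),
      ∑ lam : Fin 3, Dx lam (fun r => ∑ α : Fin 3, ∑ μ : Fin 3,
          a lam α r * a μ α r * Dx μ (Dt q) r) p
        = ∑ lam : Fin 3, Dx lam (fun r => ∑ α : Fin 3,
            (Dt (Dt (a lam α)) r * v r α
              + Dt (a lam α) r * Dt (fun r' => v r' α) r
              - Dt (a lam α) r * Dx α q r
              + Dt (a lam α) r * ∑ μ : Fin 3,
                  ((if μ = α then (1 : ℝ) else 0) - a μ α r) * Dx μ q r
              - a lam α r * ∑ μ : Fin 3, Dt (a μ α) r * Dx μ q r)) p := by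
  intro p
  have hsa (μ α) : ContDiff ℝ (⊤ : ℕ∞) (a μ α) := ha μ α ▸ contDiff_cof hη μ α
  have hsv := contDiff_pi.1 hv
  have hDtv (α) : Dt (fun r => v r α) = fun r => -∑ μ : Fin 3, a μ α r * Dx μ q r :=
    funext fun r => eq_neg_of_add_eq_zero_left (heuler r α)
  have hDtDtv (α r) : Dt (Dt (fun r => v r α)) r
      = -∑ μ : Fin 3, (Dt (a μ α) r * Dx μ q r + a μ α r * Dx μ (Dt q) r) := by
    rw [hDtv, Dt_neg, Dt_sum fun μ => (hsa μ α).mul (hq.Dx μ)]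
    simp only [Dt_mul (hsa _ α) (hq.Dx _), Dx_Dt_comm _ hq]
  let W (lam : Fin 3) : ℝ × (Fin 3 → ℝ) → ℝ := fun r => ∑ α : Fin 3, a lam α r * v r α
  have hsW (lam) : ContDiff ℝ (⊤ : ℕ∞) (W lam) :=
    ContDiff.sum fun α _ => (hsa lam α).mul (hsv α)
  have hDtDtW (lam r) : Dt (Dt (W lam)) r = ∑ α : Fin 3, (Dt (Dt (a lam α)) r * v r α
      + 2 * (Dt (a lam α) r * Dt (fun r => v r α) r)
      + a lam α r * Dt (Dt (fun r => v r α)) r) := by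
    have h : Dt (W lam) = fun r => ∑ α : Fin 3,
        (Dt (a lam α) r * v r α + a lam α r * Dt (fun r => v r α) r) := by
      funext r
      simp only [W, Dt_sum fun α => (hsa lam α).mul (hsv α), Dt_mul (hsa lam _) (hsv _)]
    rw [h, Dt_sum fun α => ((hsa lam α).Dt.mul (hsv α)).add ((hsa lam α).mul (hsv α).Dt)]
    refine Finset.sum_congr rfl fun α _ => ?_
    rw [Dt_add ((hsa lam α).Dt.mul (hsv α)) ((hsa lam α).mul (hsv α).Dt),
      Dt_mul (hsa lam α).Dt (hsv α), Dt_mul (hsa lam α) (hsv α).Dt]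
    ring
  have hdivW : (fun r => ∑ lam : Fin 3, Dx lam (W lam) r) = fun _ => 0 := by
    funext r
    simp only [W, Dx_sum _ fun α => (hsa _ α).mul (hsv α), Dx_mul _ (hsa _ _) (hsv _),
      Finset.sum_add_distrib, hdiv r, add_zero]
    rw [Finset.sum_comm]
    simp only [← Finset.sum_mul, ha, sum_Dx_cof_eq_zero hη, zero_mul, Finset.sum_const_zero]
  have hdivDtDtW : ∑ lam : Fin 3, Dx lam (Dt (Dt (W lam))) p = 0 := by
    simp only [Dx_Dt_comm _ (hsW _).Dt, Dx_Dt_comm _ (hsW _)]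
    have h : Dt (fun r => ∑ lam : Fin 3, Dx lam (W lam) r)
        = fun r => ∑ lam : Fin 3, Dt (Dx lam (W lam)) r :=
      funext (Dt_sum fun lam => (hsW lam).Dx lam)
    rw [← Dt_sum fun lam => ((hsW lam).Dx lam).Dt, ← h, hdivW]
    simp [Dt]
  have hsF (lam) : ContDiff ℝ (⊤ : ℕ∞) (fun r => ∑ α : Fin 3, ∑ μ : Fin 3,
      a lam α r * a μ α r * Dx μ (Dt q) r) :=
    ContDiff.sum fun α _ => ContDiff.sum fun μ _ =>
      ((hsa lam α).mul (hsa μ α)).mul (hq.Dt.Dx μ)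
  refine (add_zero _).symm.trans ((congrArg _ hdivDtDtW.symm).trans ?_)
  rw [← Finset.sum_add_distrib]
  refine Finset.sum_congr rfl fun lam _ => ?_
  rw [← Dx_add lam (hsF lam) (hsW lam).Dt.Dt]
  congr 1
  funext r
  rw [hDtDtW, ← Finset.sum_add_distrib]
  refine Finset.sum_congr rfl fun α _ => ?_
  have hδ : ∑ μ : Fin 3, ((if μ = α then (1 : ℝ) else 0) - a μ α r) * Dx μ q r
      = Dx α q r + Dt (fun r => v r α) r := by
    rw [hDtv, ← sub_eq_add_neg]
    simp [sub_mul]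
  simp only [hδ, hDtDtv, mul_assoc, ← Finset.mul_sum, Finset.sum_add_distrib]
  ring
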